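/- For every integer n ≥ 1, the triple integrals r(n) = ∭_{[0,1]³} (x(1-x)y(1-y)z(1-z)/(1-(1-xy)z))ⁿ · dx dy dz/(1-(1-xy)z) satisfy the homogeneous big Apéry recurrence (n+1)³·r(n+1) = (2n+1)(17n² + 17n + 5)·r(n) - n³·r(n-1). -/

import Mathlib

open MeasureTheory

/-- The triple integral
`r(n) = ∭_{[0,1]³} (x(1-x)y(1-y)z(1-z)/(1-(1-xy)z))ⁿ · dx dy dz/(1-(1-xy)z)`. -/
noncomputable def aperyR (n : ℕ) : ℝ :=
  ∫ p in Set.Ioo (0 : ℝ) 1 ×ˢ Set.Ioo (0 : ℝ) 1 ×ˢ Set.Ioo (0 : ℝ) 1,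
    (p.1 * (1 - p.1) * p.2.1 * (1 - p.2.1) * p.2.2 * (1 - p.2.2) /
        (1 - (1 - p.1 * p.2.1) * p.2.2)) ^ n /
      (1 - (1 - p.1 * p.2.1) * p.2.2)

namespace Apery

open Set Filter Asymptotics

/-! ### Iterated integrals that vanish -/

theorem setIntegral_prod_eq_zero_of_right {α β : Type*} [MeasureSpace α] [MeasureSpace β]
    [SFinite (volume : Measure α)] [SFinite (volume : Measure β)] {s : Set α} {t : Set β}
    (hs : MeasurableSet s) {f : α × β → ℝ} (h : ∀ x ∈ s, ∫ y in t, f (x, y) = 0) :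
    ∫ p in s ×ˢ t, f p = 0 := by
  by_cases hf : IntegrableOn f (s ×ˢ t)
  · rw [Measure.volume_eq_prod] at hf ⊢
    rw [setIntegral_prod f hf, setIntegral_congr_fun hs h]
    simp
  · exact integral_undef hf

theorem setIntegral_prod_eq_zero_of_left {α β : Type*} [MeasureSpace α] [MeasureSpace β]
    [SFinite (volume : Measure α)] [SFinite (volume : Measure β)] {s : Set α} {t : Set β}
    (ht : MeasurableSet t) {f : α × β → ℝ} (h : ∀ y ∈ t, ∫ x in s, f (x, y) = 0) :
    ∫ p in s ×ˢ t, f p = 0 := by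
  by_cases hf : IntegrableOn f (s ×ˢ t)
  · rw [Measure.volume_eq_prod] at hf ⊢
    rw [IntegrableOn, ← Measure.prod_restrict] at hf
    rw [← Measure.prod_restrict, integral_prod_symm f hf, setIntegral_congr_fun ht h]
    simp
  · exact integral_undef hf

/-- If `q` vanishes at both ends of `[0, 1]`, then so does the integral of the derivative of
`q ^ (m + 1) * c ^ m * P / D ^ (m + 2)`. -/
theorem setIntegral_deriv_eq_zero (m : ℕ) (c : ℝ) {q q' P P' D D' : ℝ → ℝ}
    (hq : ∀ t, HasDerivAt q (q' t) t) (hP : ∀ t, HasDerivAt P (P' t) t)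
    (hD : ∀ t, HasDerivAt D (D' t) t) (cq : Continuous q') (cP : Continuous P')
    (cD : Continuous D') (h0 : q 0 = 0) (h1 : q 1 = 0) (hpos : ∀ t ∈ Icc (0 : ℝ) 1, 0 < D t) :
    ∫ t in Ioo (0 : ℝ) 1, (q t * c) ^ m / D t ^ (m + 3) *
      ((m + 1) * q' t * P t * D t + q t * P' t * D t - (m + 2) * q t * D' t * P t) = 0 := by
  have cq0 : Continuous q := continuous_iff_continuousAt.2 fun t => (hq t).continuousAt
  have cP0 : Continuous P := continuous_iff_continuousAt.2 fun t => (hP t).continuousAt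
  have cD0 : Continuous D := continuous_iff_continuousAt.2 fun t => (hD t).continuousAt
  rw [← integral_Ioc_eq_integral_Ioo, ← intervalIntegral.integral_of_le zero_le_one,
    intervalIntegral.integral_eq_sub_of_hasDerivAt
      (f := fun t => q t ^ (m + 1) * c ^ m * P t / D t ^ (m + 2))]
  · simp [h0, h1]
  · intro t ht
    rw [uIcc_of_le zero_le_one] at ht
    have hne : D t ≠ 0 := (hpos t ht).ne'
    refine ((((hq t).pow (m + 1)).mul_const (c ^ m)).mul (hP t) |>.div ((hD t).pow (m + 2))
      (pow_ne_zero _ hne)).congr_deriv ?_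
    simp only [Pi.pow_apply, Pi.mul_apply, Nat.add_sub_cancel,
      show m + 2 - 1 = m + 1 from rfl]
    push_cast
    field_simp
    ring
  · apply ContinuousOn.intervalIntegrable
    rw [uIcc_of_le zero_le_one]
    refine ContinuousOn.mul (ContinuousOn.div (by fun_prop) (by fun_prop) fun t ht => ?_)
      (by fun_prop)
    exact pow_ne_zero _ (hpos t ht).ne'

/-! ### The denominator -/

/-- The open unit cube. -/
abbrev cube : Set (ℝ × ℝ × ℝ) := Ioo (0 : ℝ) 1 ×ˢ Ioo (0 : ℝ) 1 ×ˢ Ioo (0 : ℝ) 1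

/-- The denominator `1 - (1 - xy)z` of the Beukers integral. -/
def den (x y z : ℝ) : ℝ := 1 - (1 - x * y) * z

/-- The numerator `x(1-x)y(1-y)z(1-z)` of the Beukers integral. -/
def num (x y z : ℝ) : ℝ := x * (1 - x) * y * (1 - y) * z * (1 - z)

theorem den_comm (x y z : ℝ) : den y x z = den x y z := by
  unfold den; ring

theorem num_comm (x y z : ℝ) : num y x z = num x y z := by
  unfold num; ring

section Bounds

variable {x y z : ℝ}

theorem mul_le_den (hx : x ∈ Icc (0 : ℝ) 1) (hy : y ∈ Icc (0 : ℝ) 1) (hz : z ∈ Icc (0 : ℝ) 1) :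
    x * y ≤ den x y z := by
  have := mul_nonneg (sub_nonneg.2 hz.2) (sub_nonneg.2 (mul_le_one₀ hx.2 hy.1 hy.2))
  unfold den
  linarith

theorem one_sub_le_den (hx : 0 ≤ x) (hy : 0 ≤ y) (hz : 0 ≤ z) : 1 - z ≤ den x y z := by
  have := mul_nonneg (mul_nonneg hx hy) hz
  unfold den
  linarith

theorem den_pos_of_lt_one (hx : 0 ≤ x) (hy : 0 ≤ y) (hz : z ∈ Ioo (0 : ℝ) 1) : 0 < den x y z :=
  (sub_pos.2 hz.2).trans_le (one_sub_le_den hx hy hz.1.le)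

theorem den_pos_of_pos (hx : x ∈ Ioo (0 : ℝ) 1) (hy : y ∈ Ioo (0 : ℝ) 1)
    (hz : z ∈ Icc (0 : ℝ) 1) : 0 < den x y z :=
  (mul_pos hx.1 hy.1).trans_le (mul_le_den (Ioo_subset_Icc_self hx) (Ioo_subset_Icc_self hy) hz)

theorem num_nonneg (hx : x ∈ Ioo (0 : ℝ) 1) (hy : y ∈ Ioo (0 : ℝ) 1) (hz : z ∈ Ioo (0 : ℝ) 1) :
    0 ≤ num x y z := by
  have := sub_pos.2 hx.2
  have := sub_pos.2 hy.2
  have := sub_pos.2 hz.2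
  have := hx.1
  have := hy.1
  have := hz.1
  unfold num
  positivity

theorem num_le_den (hx : x ∈ Ioo (0 : ℝ) 1) (hy : y ∈ Ioo (0 : ℝ) 1) (hz : z ∈ Ioo (0 : ℝ) 1) :
    num x y z ≤ den x y z := by
  refine le_trans ?_ (one_sub_le_den hx.1.le hy.1.le hz.1.le)
  have h1 : x * (1 - x) ≤ 1 := by nlinarith [hx.1, hx.2]
  have h2 : y * (1 - y) ≤ 1 := by nlinarith [hy.1, hy.2]
  have h2' : 0 ≤ y * (1 - y) := mul_nonneg hy.1.le (sub_nonneg.2 hy.2.le)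
  have h3 : x * (1 - x) * (y * (1 - y)) ≤ 1 := mul_le_one₀ h1 h2' h2
  have h4 : x * (1 - x) * (y * (1 - y)) * z ≤ 1 := mul_le_one₀ h3 hz.1.le hz.2.le
  calc num x y z = x * (1 - x) * (y * (1 - y)) * z * (1 - z) := by unfold num; ring
    _ ≤ 1 * (1 - z) := mul_le_mul_of_nonneg_right h4 (sub_nonneg.2 hz.2.le)
    _ = 1 - z := one_mul _

theorem one_div_den_le (hx : x ∈ Ioo (0 : ℝ) 1) (hy : y ∈ Ioo (0 : ℝ) 1)
    (hz : z ∈ Ioo (0 : ℝ) 1) :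
    1 / den x y z ≤ x ^ (-1 / 2 : ℝ) * (y ^ (-1 / 2 : ℝ) * (1 - z) ^ (-1 / 2 : ℝ)) := by
  have hw : 0 < 1 - z := sub_pos.2 hz.2
  have hxy : 0 < x * y := mul_pos hx.1 hy.1
  have hD : 0 < den x y z := den_pos_of_lt_one hx.1.le hy.1.le hz
  have hle : x * y * (1 - z) ≤ den x y z ^ 2 := by
    rw [sq]
    exact mul_le_mul
      (mul_le_den (Ioo_subset_Icc_self hx) (Ioo_subset_Icc_self hy) (Ioo_subset_Icc_self hz))
      (one_sub_le_den hx.1.le hy.1.le hz.1.le) hw.le hD.le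
  calc 1 / den x y z = (den x y z ^ 2) ^ (-1 / 2 : ℝ) := by
        rw [← Real.rpow_natCast, ← Real.rpow_mul hD.le, one_div, ← Real.rpow_neg_one]
        norm_num
    _ ≤ (x * y * (1 - z)) ^ (-1 / 2 : ℝ) :=
        Real.rpow_le_rpow_of_nonpos (mul_pos hxy hw) hle (by norm_num)
    _ = _ := by
        rw [Real.mul_rpow hxy.le hw.le, Real.mul_rpow hx.1.le hy.1.le, mul_assoc]

end Bounds

theorem integrableOn_cube_of_abs_le {f : ℝ × ℝ × ℝ → ℝ} (hf : Measurable f) {C : ℝ}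
    (hC : ∀ p ∈ cube, |f p| ≤ C / den p.1 p.2.1 p.2.2) : IntegrableOn f cube := by
  have h1 : IntegrableOn (fun x : ℝ => x ^ (-1 / 2 : ℝ)) (Ioo 0 1) :=
    (intervalIntegral.integrableOn_Ioo_rpow_iff one_pos).2 (by norm_num)
  have h2 : IntegrableOn (fun x : ℝ => (1 - x) ^ (-1 / 2 : ℝ)) (Ioo 0 1) := by
    have h := (intervalIntegral.intervalIntegrable_rpow' (a := 0) (b := 1)
      (r := -1 / 2) (by norm_num)).comp_sub_left 1
    simp only [sub_zero, sub_self] at h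
    exact ((intervalIntegrable_iff_integrableOn_Ioo_of_le zero_le_one).1 h.symm)
  have h3 : IntegrableOn (fun p : ℝ × ℝ × ℝ =>
      p.1 ^ (-1 / 2 : ℝ) * (p.2.1 ^ (-1 / 2 : ℝ) * (1 - p.2.2) ^ (-1 / 2 : ℝ))) cube := by
    rw [IntegrableOn, Measure.volume_eq_prod, ← Measure.prod_restrict, Measure.volume_eq_prod,
      ← Measure.prod_restrict]
    exact Integrable.mul_prod h1 (Integrable.mul_prod h1 h2)
  have hm : MeasurableSet cube := measurableSet_Ioo.prod (measurableSet_Ioo.prod measurableSet_Ioo)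
  refine (h3.const_mul |C|).mono' hf.aestronglyMeasurable ?_
  refine (ae_restrict_iff' hm).2 (ae_of_all _ fun p hp => ?_)
  obtain ⟨hx, hy, hz⟩ := hp
  have hD : 0 < den p.1 p.2.1 p.2.2 := den_pos_of_lt_one hx.1.le hy.1.le hz
  calc ‖f p‖ ≤ C / den p.1 p.2.1 p.2.2 := hC p ⟨hx, hy, hz⟩
    _ ≤ |C| * (1 / den p.1 p.2.1 p.2.2) := by
        rw [mul_one_div]
        exact div_le_div_of_nonneg_right (le_abs_self C) hD.le
    _ ≤ _ := mul_le_mul_of_nonneg_left (one_div_den_le hx hy hz) (abs_nonneg C)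

/-! ### The vector field whose divergence gives the recurrence -/

/-- Coefficient of `w` in `fluxX`, with `w = 1 - z`. -/
noncomputable def fluxXW₀ (s y w : ℝ) : ℝ :=
  (s ^ 2) +
  (-31 * s ^ 2 - 36 * s - 15) * w +
  (8 * s ^ 2 + 15 * s + 7) * w ^ 2 +
  (-2 * s ^ 2 - 6 * s - 2) * y +
  (11 * s ^ 2 + 3 * s) * y * w +
  (-3 * s ^ 2 - 6 * s - 3) * y * w ^ 2 +
  (8 * s ^ 2 + 8 * s + 2) * y ^ 2 +
  (12 * s ^ 2 + 22 * s + 8) * y ^ 2 * w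

/-- Coefficient of `w * x` in `fluxX`, with `w = 1 - z`. -/
noncomputable def fluxXW₁ (s y w : ℝ) : ℝ :=
  (4 * s ^ 2 + 2 * s) +
  (6 * s ^ 2 + 10 * s + 2) * w +
  (-2 * s ^ 2 - 4 * s - 2) * w ^ 2 +
  (-109 * s ^ 2 - 97 * s - 28) * y +
  (47 * s ^ 2 + 53 * s + 20) * y * w +
  (44 * s ^ 2 + 55 * s + 18) * y ^ 2 +
  (-32 * s ^ 2 - 39 * s - 13) * y ^ 2 * w

/-- Coefficient of `w * x ^ 2` in `fluxX`, with `w = 1 - z`. -/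
noncomputable def fluxXW₂ (s y w : ℝ) : ℝ :=
  (2 * s ^ 2 - 2) * y +
  (2 * s + 2) * y * w +
  (4 * s ^ 2 + 7 * s + 3) * y ^ 2 * w +
  (-4 * s ^ 2 - 7 * s - 3) * y ^ 2 * w ^ 2 +
  (-s ^ 2 - 2 * s - 1) * y ^ 3 * w +
  (s ^ 2 + 2 * s + 1) * y ^ 3 * w ^ 2

/-- Coefficient of `x * y` in `fluxX`. -/
noncomputable def fluxXM₀ (s y : ℝ) : ℝ :=
  (33 * s ^ 2 + 28 * s + 8) +
  (-10 * s ^ 2 - 14 * s - 5) * y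

/-- Coefficient of `x ^ 2 * y` in `fluxX`. -/
noncomputable def fluxXM₁ (s : ℝ) : ℝ :=
  -2 * s ^ 2 - 2 * s

/-- Coefficient of `x * y` in `fluxZ`. -/
noncomputable def fluxZ₀ (s x y : ℝ) : ℝ :=
  (-2 * s ^ 2) +
  (-33 * s ^ 2 - 30 * s - 10) * y +
  (2 * s ^ 2 + 4 * s + 2) * y ^ 2 +
  (-33 * s ^ 2 - 30 * s - 10) * x +
  (20 * s ^ 2 + 28 * s + 10) * x * y +
  (2 * s ^ 2 + 4 * s + 2) * x ^ 2

/-- Coefficient of `1 - z` in `fluxZ`. -/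
noncomputable def fluxZ₁ (s x y : ℝ) : ℝ :=
  (62 * s ^ 2 + 56 * s + 16) +
  (-79 * s ^ 2 - 70 * s - 21) * y +
  (-79 * s ^ 2 - 70 * s - 21) * x +
  (112 * s ^ 2 + 96 * s + 26) * x * y

/-- Coefficient of `(1 - z) ^ 2` in `fluxZ`. -/
noncomputable def fluxZ₂ (s x y : ℝ) : ℝ :=
  (-16 * s ^ 2 - 14 * s) +
  (21 * s ^ 2 + 21 * s + 2) * y +
  (-4 * s ^ 2 - 6 * s - 2) * y ^ 2 +
  (21 * s ^ 2 + 21 * s + 2) * x +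
  (-28 * s ^ 2 - 42 * s - 14) * x * y +
  (13 * s ^ 2 + 25 * s + 12) * x * y ^ 2 +
  (-2 * s ^ 2 - 4 * s - 2) * x * y ^ 3 +
  (-4 * s ^ 2 - 6 * s - 2) * x ^ 2 +
  (13 * s ^ 2 + 25 * s + 12) * x ^ 2 * y +
  (-12 * s ^ 2 - 16 * s - 6) * x ^ 2 * y ^ 2 +
  (-2 * s ^ 2 - 4 * s - 2) * x ^ 3 * y

/-- Polynomial factor of the first component of the vector field. -/
noncomputable def fluxX (s x y z : ℝ) : ℝ :=
  (1 - z) * (fluxXW₀ s y (1 - z) + fluxXW₁ s y (1 - z) * x + fluxXW₂ s y (1 - z) * x ^ 2) +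
    x * y * (fluxXM₀ s y + fluxXM₁ s * x)

/-- The derivative of `fluxX` with respect to `x`. -/
noncomputable def fluxXDeriv (s x y z : ℝ) : ℝ :=
  (1 - z) * (fluxXW₁ s y (1 - z) + 2 * fluxXW₂ s y (1 - z) * x) +
    y * (fluxXM₀ s y + 2 * fluxXM₁ s * x)

/-- Polynomial factor of the third component of the vector field. -/
noncomputable def fluxZ (s x y z : ℝ) : ℝ :=
  x * y * fluxZ₀ s x y + (1 - z) * (fluxZ₁ s x y + fluxZ₂ s x y * (1 - z))

/-- The derivative of `fluxZ` with respect to `z`. -/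
noncomputable def fluxZDeriv (s x y z : ℝ) : ℝ :=
  -(fluxZ₁ s x y + 2 * fluxZ₂ s x y * (1 - z))

/-- Polynomial factor of the partial derivative in `x` of the first component. -/
noncomputable def divXPoly (m x y z : ℝ) : ℝ :=
  (m + 1) * (1 - 2 * x) * fluxX (m + 1) x y z * den x y z +
    x * (1 - x) * fluxXDeriv (m + 1) x y z * den x y z -
    (m + 2) * (x * (1 - x)) * (y * z) * fluxX (m + 1) x y z

/-- Polynomial factor of the partial derivative in `z` of the third component. -/
noncomputable def divZPoly (m x y z : ℝ) : ℝ :=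
  (m + 1) * (1 - 2 * z) * fluxZ (m + 1) x y z * den x y z +
    z * (1 - z) * fluxZDeriv (m + 1) x y z * den x y z -
    (m + 2) * (z * (1 - z)) * (-(1 - x * y)) * fluxZ (m + 1) x y z

theorem divergence_eq (m x y z : ℝ) :
    2 * ((m + 2) ^ 3 * num x y z ^ 2 -
        (2 * m + 3) * (17 * (m + 1) ^ 2 + 17 * (m + 1) + 5) * num x y z * den x y z +
        (m + 1) ^ 3 * den x y z ^ 2) =
      divXPoly m x y z + divXPoly m y x z + divZPoly m x y z := by
  simp only [divXPoly, divZPoly, fluxX, fluxXDeriv, fluxZ, fluxZDeriv, num, den, fluxXW₀, fluxXW₁,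
    fluxXW₂, fluxXM₀, fluxXM₁, fluxZ₀, fluxZ₁, fluxZ₂]
  ring

/-- The partial derivative in `x` of the first component of the vector field. -/
noncomputable def divX (m : ℕ) (x y z : ℝ) : ℝ :=
  num x y z ^ m / den x y z ^ (m + 3) * divXPoly m x y z

/-- The partial derivative in `z` of the third component of the vector field. -/
noncomputable def divZ (m : ℕ) (x y z : ℝ) : ℝ :=
  num x y z ^ m / den x y z ^ (m + 3) * divZPoly m x y z

theorem setIntegral_divX (m : ℕ) {y z : ℝ} (hy : y ∈ Ioo (0 : ℝ) 1) (hz : z ∈ Ioo (0 : ℝ) 1) :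
    ∫ x in Ioo (0 : ℝ) 1, divX m x y z = 0 := by
  have h := setIntegral_deriv_eq_zero m (y * (1 - y) * z * (1 - z))
    (q := fun x => x * (1 - x)) (q' := fun x => 1 - 2 * x)
    (P := fun x => fluxX (m + 1) x y z) (P' := fun x => fluxXDeriv (m + 1) x y z)
    (D := fun x => den x y z) (D' := fun _ => y * z)
    (fun t => ((hasDerivAt_id t).mul ((hasDerivAt_id t).const_sub 1)).congr_deriv
      (by simp only [id]; ring))
    (fun t => by
      refine ((((((hasDerivAt_id t).const_mul (fluxXW₁ (m + 1) y (1 - z))).const_add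
        (fluxXW₀ (m + 1) y (1 - z))).add
        (((hasDerivAt_id t).pow 2).const_mul (fluxXW₂ (m + 1) y (1 - z)))).const_mul (1 - z)).add
        (((hasDerivAt_id t).mul_const y).mul
          (((hasDerivAt_id t).const_mul (fluxXM₁ (m + 1))).const_add
            (fluxXM₀ (m + 1) y)))).congr_deriv ?_
      simp only [id, fluxXDeriv]
      push_cast
      ring)
    (fun t => (((((hasDerivAt_id t).mul_const y).const_sub 1).mul_const z).const_sub 1).congr_deriv
      (by ring))
    (by fun_prop) (by unfold fluxXDeriv; fun_prop) (by fun_prop) (by simp) (by simp)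
    (fun t ht => den_pos_of_lt_one ht.1 hy.1.le hz)
  refine Eq.trans ?_ h
  refine setIntegral_congr_fun measurableSet_Ioo fun x _ => ?_
  simp only [divX, divXPoly, num]
  ring_nf

theorem setIntegral_divZ (m : ℕ) {x y : ℝ} (hx : x ∈ Ioo (0 : ℝ) 1) (hy : y ∈ Ioo (0 : ℝ) 1) :
    ∫ z in Ioo (0 : ℝ) 1, divZ m x y z = 0 := by
  have h := setIntegral_deriv_eq_zero m (x * (1 - x) * y * (1 - y))
    (q := fun z => z * (1 - z)) (q' := fun z => 1 - 2 * z)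
    (P := fun z => fluxZ (m + 1) x y z) (P' := fun z => fluxZDeriv (m + 1) x y z)
    (D := fun z => den x y z) (D' := fun _ => -(1 - x * y))
    (fun t => ((hasDerivAt_id t).mul ((hasDerivAt_id t).const_sub 1)).congr_deriv
      (by simp only [id]; ring))
    (fun t => by
      refine ((((hasDerivAt_id t).const_sub 1).mul
        ((((hasDerivAt_id t).const_sub 1).const_mul (fluxZ₂ (m + 1) x y)).const_add
          (fluxZ₁ (m + 1) x y))).const_add (x * y * fluxZ₀ (m + 1) x y)).congr_deriv ?_
      simp only [id, fluxZDeriv]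
      ring)
    (fun t => (((hasDerivAt_id t).const_mul (1 - x * y)).const_sub 1).congr_deriv (by ring))
    (by fun_prop) (by unfold fluxZDeriv; fun_prop) (by fun_prop) (by simp) (by simp)
    (fun t ht => den_pos_of_pos hx hy ht)
  refine Eq.trans ?_ h
  refine setIntegral_congr_fun measurableSet_Ioo fun z _ => ?_
  simp only [divZ, divZPoly, num]
  ring_nf

/-! ### Integrability -/

section Growth

/-- The denominator as a function on the cube. -/
abbrev denFun (p : ℝ × ℝ × ℝ) : ℝ := den p.1 p.2.1 p.2.2

theorem isBigO_one_of_continuous {f : ℝ × ℝ × ℝ → ℝ} (hf : Continuous f) :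
    f =O[𝓟 cube] fun _ => (1 : ℝ) := by
  have h : IsCompact (Icc (0 : ℝ) 1 ×ˢ Icc (0 : ℝ) 1 ×ˢ Icc (0 : ℝ) 1) :=
    isCompact_Icc.prod (isCompact_Icc.prod isCompact_Icc)
  refine (hf.continuousOn.isBigO_principal h (c := (1 : ℝ)) (by simp)).mono ?_
  exact principal_mono.2 (prod_mono Ioo_subset_Icc_self
    (prod_mono Ioo_subset_Icc_self Ioo_subset_Icc_self))

theorem isBigO_mul_den {f : ℝ × ℝ × ℝ → ℝ} (hf : Continuous f) :
    (fun p => p.1 * p.2.1 * f p) =O[𝓟 cube] denFun := by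
  have h : (fun p : ℝ × ℝ × ℝ => p.1 * p.2.1) =O[𝓟 cube] denFun := by
    refine isBigO_principal.2 ⟨1, fun p ⟨hx, hy, hz⟩ => ?_⟩
    rw [one_mul]
    exact abs_le_abs_of_nonneg (mul_pos hx.1 hy.1).le
      (mul_le_den (Ioo_subset_Icc_self hx) (Ioo_subset_Icc_self hy) (Ioo_subset_Icc_self hz))
  simpa using h.mul (isBigO_one_of_continuous hf)

theorem isBigO_one_sub_den {f : ℝ × ℝ × ℝ → ℝ} (hf : Continuous f) :
    (fun p => (1 - p.2.2) * f p) =O[𝓟 cube] denFun := by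
  have h : (fun p : ℝ × ℝ × ℝ => 1 - p.2.2) =O[𝓟 cube] denFun := by
    refine isBigO_principal.2 ⟨1, fun p ⟨hx, hy, hz⟩ => ?_⟩
    rw [one_mul]
    exact abs_le_abs_of_nonneg (sub_pos.2 hz.2).le (one_sub_le_den hx.1.le hy.1.le hz.1.le)
  simpa using h.mul (isBigO_one_of_continuous hf)

theorem isBigO_divXPoly (m : ℝ) :
    (fun p : ℝ × ℝ × ℝ => divXPoly m p.1 p.2.1 p.2.2) =O[𝓟 cube] fun p => denFun p ^ 2 := by
  have hW : Continuous fun p : ℝ × ℝ × ℝ => fluxXW₀ (m + 1) p.2.1 (1 - p.2.2) +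
      fluxXW₁ (m + 1) p.2.1 (1 - p.2.2) * p.1 +
      fluxXW₂ (m + 1) p.2.1 (1 - p.2.2) * p.1 ^ 2 := by
    unfold fluxXW₀ fluxXW₁ fluxXW₂; fun_prop
  have hM : Continuous fun p : ℝ × ℝ × ℝ =>
      fluxXM₀ (m + 1) p.2.1 + fluxXM₁ (m + 1) * p.1 := by
    unfold fluxXM₀ fluxXM₁; fun_prop
  have hW' : Continuous fun p : ℝ × ℝ × ℝ => p.1 * (1 - p.1) *
      (fluxXW₁ (m + 1) p.2.1 (1 - p.2.2) + 2 * fluxXW₂ (m + 1) p.2.1 (1 - p.2.2) * p.1) := by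
    unfold fluxXW₁ fluxXW₂; fun_prop
  have hM' : Continuous fun p : ℝ × ℝ × ℝ =>
      (1 - p.1) * (fluxXM₀ (m + 1) p.2.1 + 2 * fluxXM₁ (m + 1) * p.1) := by
    unfold fluxXM₀ fluxXM₁; fun_prop
  have hF : (fun p : ℝ × ℝ × ℝ => fluxX (m + 1) p.1 p.2.1 p.2.2) =O[𝓟 cube] denFun :=
    (isBigO_one_sub_den hW).add (isBigO_mul_den hM)
  have hF' := (isBigO_one_sub_den hW').add (isBigO_mul_den hM')
  have hq := isBigO_mul_den (f := fun p => (m + 2) * (1 - p.1) * p.2.2) (by fun_prop)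
  have hD := isBigO_refl denFun (𝓟 cube)
  have h1 := isBigO_one_of_continuous (f := fun p => (m + 1) * (1 - 2 * p.1)) (by fun_prop)
  refine (((h1.mul (hF.mul hD)).add ((hF'.mul hD).congr_right fun p => (one_mul _).symm)).sub
    ((hq.mul hF).congr_right fun p => (one_mul _).symm)).congr (fun p => ?_) fun p => ?_
  · simp only [divXPoly, fluxXDeriv]
    ring
  · ring

theorem isBigO_divZPoly (m : ℝ) :
    (fun p : ℝ × ℝ × ℝ => divZPoly m p.1 p.2.1 p.2.2) =O[𝓟 cube] fun p => denFun p ^ 2 := by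
  have hM : Continuous fun p : ℝ × ℝ × ℝ => fluxZ₀ (m + 1) p.1 p.2.1 := by
    unfold fluxZ₀; fun_prop
  have hW : Continuous fun p : ℝ × ℝ × ℝ =>
      fluxZ₁ (m + 1) p.1 p.2.1 + fluxZ₂ (m + 1) p.1 p.2.1 * (1 - p.2.2) := by
    unfold fluxZ₁ fluxZ₂; fun_prop
  have hW' : Continuous fun p : ℝ × ℝ × ℝ => p.2.2 *
      -(fluxZ₁ (m + 1) p.1 p.2.1 + 2 * fluxZ₂ (m + 1) p.1 p.2.1 * (1 - p.2.2)) := by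
    unfold fluxZ₁ fluxZ₂; fun_prop
  have hF : (fun p : ℝ × ℝ × ℝ => fluxZ (m + 1) p.1 p.2.1 p.2.2) =O[𝓟 cube] denFun :=
    (isBigO_mul_den hM).add (isBigO_one_sub_den hW)
  have hF' := isBigO_one_sub_den hW'
  have hq := isBigO_one_sub_den (f := fun p => (m + 2) * p.2.2 * (-(1 - p.1 * p.2.1)))
    (by fun_prop)
  have hD := isBigO_refl denFun (𝓟 cube)
  have h1 := isBigO_one_of_continuous (f := fun p => (m + 1) * (1 - 2 * p.2.2)) (by fun_prop)
  refine (((h1.mul (hF.mul hD)).add ((hF'.mul hD).congr_right fun p => (one_mul _).symm)).sub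
    ((hq.mul hF).congr_right fun p => (one_mul _).symm)).congr (fun p => ?_) fun p => ?_
  · simp only [divZPoly, fluxZDeriv]
    ring
  · ring

end Growth

theorem exists_abs_le_div_den (m : ℕ) {K : ℝ → ℝ → ℝ → ℝ}
    (hK : (fun p : ℝ × ℝ × ℝ => K p.1 p.2.1 p.2.2) =O[𝓟 cube] fun p => denFun p ^ 2) :
    ∃ C, ∀ x ∈ Ioo (0 : ℝ) 1, ∀ y ∈ Ioo (0 : ℝ) 1, ∀ z ∈ Ioo (0 : ℝ) 1,
      |num x y z ^ m / den x y z ^ (m + 3) * K x y z| ≤ C / den x y z := by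
  obtain ⟨C, hC⟩ := isBigO_principal.1 hK
  refine ⟨C, fun x hx y hy z hz => ?_⟩
  have hD : 0 < den x y z := den_pos_of_lt_one hx.1.le hy.1.le hz
  have hN := num_nonneg hx hy hz
  have hle : (num x y z / den x y z) ^ m ≤ 1 :=
    pow_le_one₀ (div_nonneg hN hD.le) ((div_le_one hD).2 (num_le_den hx hy hz))
  have hKp : |K x y z| ≤ C * den x y z ^ 2 := by
    have := hC (x, y, z) ⟨hx, hy, hz⟩
    rwa [Real.norm_eq_abs, Real.norm_eq_abs, abs_of_pos (pow_pos hD 2)] at this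
  calc |num x y z ^ m / den x y z ^ (m + 3) * K x y z|
      = (num x y z / den x y z) ^ m * (|K x y z| / den x y z ^ 3) := by
        rw [abs_mul, abs_of_nonneg (by positivity), div_pow, pow_add]
        field_simp
    _ ≤ 1 * (C * den x y z ^ 2 / den x y z ^ 3) := by gcongr
    _ = C / den x y z := by field_simp

theorem measurable_divX (m : ℕ) {f g h : ℝ × ℝ × ℝ → ℝ} (hf : Continuous f) (hg : Continuous g)
    (hh : Continuous h) : Measurable fun p => divX m (f p) (g p) (h p) := by
  have hK : Continuous fun p => divXPoly m (f p) (g p) (h p) := by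
    unfold divXPoly fluxX fluxXDeriv fluxXW₀ fluxXW₁ fluxXW₂ fluxXM₀ fluxXM₁ den
    fun_prop
  have hN : Continuous fun p => num (f p) (g p) (h p) := by unfold num; fun_prop
  have hD : Continuous fun p => den (f p) (g p) (h p) := by unfold den; fun_prop
  exact ((hN.measurable.pow_const m).div (hD.measurable.pow_const (m + 3))).mul hK.measurable

theorem measurable_divZ (m : ℕ) :
    Measurable fun p : ℝ × ℝ × ℝ => divZ m p.1 p.2.1 p.2.2 := by
  have h : Continuous fun p : ℝ × ℝ × ℝ => divZPoly m p.1 p.2.1 p.2.2 := by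
    unfold divZPoly fluxZ fluxZDeriv fluxZ₀ fluxZ₁ fluxZ₂ den
    fun_prop
  refine Measurable.mul ?_ h.measurable
  unfold num den
  fun_prop

theorem integrableOn_divX (m : ℕ) :
    IntegrableOn (fun p : ℝ × ℝ × ℝ => divX m p.1 p.2.1 p.2.2) cube := by
  obtain ⟨C, hC⟩ := exists_abs_le_div_den m (isBigO_divXPoly m)
  exact integrableOn_cube_of_abs_le
    (measurable_divX m (by fun_prop) (by fun_prop) (by fun_prop))
    fun p ⟨hx, hy, hz⟩ => hC _ hx _ hy _ hz

theorem integrableOn_divX_swap (m : ℕ) :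
    IntegrableOn (fun p : ℝ × ℝ × ℝ => divX m p.2.1 p.1 p.2.2) cube := by
  obtain ⟨C, hC⟩ := exists_abs_le_div_den m (isBigO_divXPoly m)
  refine integrableOn_cube_of_abs_le (C := C) (measurable_divX m (by fun_prop) (by fun_prop) (by fun_prop)) fun p hp => ?_
  have h : |divX m p.2.1 p.1 p.2.2| ≤ C / den p.2.1 p.1 p.2.2 :=
    hC p.2.1 hp.2.1 p.1 hp.1 p.2.2 hp.2.2
  rwa [den_comm] at h

theorem integrableOn_divZ (m : ℕ) :
    IntegrableOn (fun p : ℝ × ℝ × ℝ => divZ m p.1 p.2.1 p.2.2) cube := by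
  obtain ⟨C, hC⟩ := exists_abs_le_div_den m (isBigO_divZPoly m)
  exact integrableOn_cube_of_abs_le (measurable_divZ m)
    fun p ⟨hx, hy, hz⟩ => hC _ hx _ hy _ hz

/-- The integrand of `aperyR n`. -/
noncomputable def integrand (n : ℕ) (p : ℝ × ℝ × ℝ) : ℝ :=
  (num p.1 p.2.1 p.2.2 / den p.1 p.2.1 p.2.2) ^ n / den p.1 p.2.1 p.2.2

theorem integrableOn_integrand (n : ℕ) : IntegrableOn (integrand n) cube := by
  refine integrableOn_cube_of_abs_le (C := 1) (by unfold integrand num den; fun_prop)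
    fun p ⟨hx, hy, hz⟩ => ?_
  have hD : 0 < den p.1 p.2.1 p.2.2 := den_pos_of_lt_one hx.1.le hy.1.le hz
  have hq : 0 ≤ num p.1 p.2.1 p.2.2 / den p.1 p.2.1 p.2.2 := div_nonneg (num_nonneg hx hy hz) hD.le
  rw [integrand, abs_of_nonneg (by positivity)]
  exact div_le_div_of_nonneg_right
    (pow_le_one₀ hq ((div_le_one hD).2 (num_le_den hx hy hz))) hD.le

theorem aperyR_eq (n : ℕ) : aperyR n = ∫ p in cube, integrand n p := rfl

/-! ### Vanishing of the integrated divergence -/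

theorem integral_divX (m : ℕ) : ∫ p in cube, divX m p.1 p.2.1 p.2.2 = 0 :=
  setIntegral_prod_eq_zero_of_left (measurableSet_Ioo.prod measurableSet_Ioo)
    fun _ hp => setIntegral_divX m hp.1 hp.2

theorem integral_divX_swap (m : ℕ) : ∫ p in cube, divX m p.2.1 p.1 p.2.2 = 0 :=
  setIntegral_prod_eq_zero_of_right measurableSet_Ioo fun _ hx =>
    setIntegral_prod_eq_zero_of_left measurableSet_Ioo fun _ hz => setIntegral_divX m hx hz

theorem integral_divZ (m : ℕ) : ∫ p in cube, divZ m p.1 p.2.1 p.2.2 = 0 :=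
  setIntegral_prod_eq_zero_of_right measurableSet_Ioo fun _ hx =>
    setIntegral_prod_eq_zero_of_right measurableSet_Ioo fun _ hy => setIntegral_divZ m hx hy

theorem integrand_recurrence (m : ℕ) {p : ℝ × ℝ × ℝ} (hp : p ∈ cube) :
    2 * (((m : ℝ) + 2) ^ 3 * integrand (m + 2) p -
        (2 * m + 3) * (17 * ((m : ℝ) + 1) ^ 2 + 17 * (m + 1) + 5) * integrand (m + 1) p +
        ((m : ℝ) + 1) ^ 3 * integrand m p) =
      divX m p.1 p.2.1 p.2.2 + divX m p.2.1 p.1 p.2.2 + divZ m p.1 p.2.1 p.2.2 := by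
  obtain ⟨x, y, z⟩ := p
  obtain ⟨hx, hy, hz⟩ := hp
  have hD : den x y z ≠ 0 := (den_pos_of_lt_one hx.1.le hy.1.le hz).ne'
  simp only [divX, divZ, num_comm x y z, den_comm x y z, ← mul_add, ← divergence_eq, integrand, div_pow]
  field_simp
  ring

end Apery

open Apery

/-- For every `n ≥ 1`, `(n+1)³·r(n+1) = (2n+1)(17n²+17n+5)·r(n) - n³·r(n-1)`. -/
theorem aperyR_recurrence (n : ℕ) (hn : 1 ≤ n) :
    ((n : ℝ) + 1) ^ 3 * aperyR (n + 1)
      = (2 * (n : ℝ) + 1) * (17 * (n : ℝ) ^ 2 + 17 * (n : ℝ) + 5) * aperyR n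
          - (n : ℝ) ^ 3 * aperyR (n - 1) := by
  obtain ⟨m, rfl⟩ := Nat.exists_eq_add_of_le' hn
  have hm : MeasurableSet cube := measurableSet_Ioo.prod (measurableSet_Ioo.prod measurableSet_Ioo)
  have h := setIntegral_congr_fun (μ := volume) hm fun p hp => integrand_recurrence m hp
  have i0 := (integrableOn_integrand m).const_mul (((m : ℝ) + 1) ^ 3)
  have i1 := (integrableOn_integrand (m + 1)).const_mul
    ((2 * m + 3) * (17 * ((m : ℝ) + 1) ^ 2 + 17 * (m + 1) + 5))
  have i2 := (integrableOn_integrand (m + 2)).const_mul (((m : ℝ) + 2) ^ 3)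
  have i21 : IntegrableOn (fun p => ((m : ℝ) + 2) ^ 3 * integrand (m + 2) p -
      (2 * m + 3) * (17 * ((m : ℝ) + 1) ^ 2 + 17 * (m + 1) + 5) * integrand (m + 1) p) cube :=
    i2.sub i1
  have iX : IntegrableOn (fun p => divX m p.1 p.2.1 p.2.2 + divX m p.2.1 p.1 p.2.2) cube :=
    (integrableOn_divX m).add (integrableOn_divX_swap m)
  rw [integral_const_mul, integral_add i21 i0, integral_sub i2 i1, integral_const_mul,
    integral_const_mul, integral_const_mul,
    integral_add iX (integrableOn_divZ m),
    integral_add (integrableOn_divX m) (integrableOn_divX_swap m), integral_divX,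
    integral_divX_swap, integral_divZ, ← aperyR_eq, ← aperyR_eq, ← aperyR_eq] at h
  rw [Nat.add_sub_cancel]
  push_cast
  linear_combination h / 2
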